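/- If r ◁ e is a rigid representation of the resource expression e and b⃗ ◁ t̄ is a rigid representation of the monomial t̄, then n_x(r) = n_x(e), |b⃗| = |t̄|, and the symmetric multilinear substitution satisfies ∂_x e · t̄ = Σ_{σ ∈ S_{|b⃗|}} |r[σ·b⃗/x]| as finite ℕ-linear sums of resource expressions (where terms of the sum equal to 0 occur when the substitution is undefined). -/

import Mathlib

set_option maxHeartbeats 1000000

/-! ### Rigid resource terms -/

/-- Rigid resource terms (de Bruijn indices for variables):
`a ::= x | λ.a | ⟨a⟩b⃗ | a⊕• | •⊕a` where argument lists are ordered. -/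
inductive Rt : Type
  | var : ℕ → Rt
  | lam : Rt → Rt
  | app : Rt → List Rt → Rt
  | inl : Rt → Rt
  | inr : Rt → Rt
deriving Inhabited

/-- Rigid resource expressions: terms or (rigid) monomials. -/
abbrev REx : Type := Rt ⊕ List Rt

/-! ### Isomorphism of rigid expressions -/

mutual
  /-- Two rigid terms are isomorphic (`≅`) when they differ only by
  permutations of argument lists. -/
  inductive IsoT : Rt → Rt → Prop
    | var (x : ℕ) : IsoT (.var x) (.var x)
    | lam {a a'} : IsoT a a' → IsoT (.lam a) (.lam a')
    | inl {a a'} : IsoT a a' → IsoT (.inl a) (.inl a')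
    | inr {a a'} : IsoT a a' → IsoT (.inr a) (.inr a')
    | app {c c' : Rt} {ds ds' : List Rt} :
        IsoT c c' → IsoM ds ds' → IsoT (.app c ds) (.app c' ds')
  /-- Isomorphism of rigid monomials: a permutation `σ` together with
  isomorphisms `aᵢ ≅ a'_{σ(i)}`. -/
  inductive IsoM : List Rt → List Rt → Prop
    | mk (as as' : List Rt) (h : as'.length = as.length) (σ : Equiv.Perm (Fin as.length))
        (H : ∀ i : Fin as.length, IsoT (as.get i) (as'.get ((σ i).cast h.symm))) :
        IsoM as as'
end

/-! ### Resource expressions as quotients of rigid expressions -/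

/-- Resource terms: rigid terms up to permutations of arguments, i.e. terms
whose argument lists are multisets. -/
def ResTerm : Type := Quot IsoT

instance : Inhabited ResTerm := ⟨Quot.mk _ (.var 0)⟩

/-- The resource term represented by a rigid term (`r ◁ |r|`). -/
def rmk : Rt → ResTerm := Quot.mk IsoT

/-- A choice of rigid representation of a resource term. -/
noncomputable def rout : ResTerm → Rt := Quot.out

/-- The resource monomial (multiset) represented by a rigid monomial (list). -/
def toMul (bs : List Rt) : Multiset ResTerm := ↑(bs.map rmk)

/-- Resource expressions: terms or monomials (finite multisets of terms). -/
abbrev ResExpr : Type := ResTerm ⊕ Multiset ResTerm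

/-- The resource expression represented by a rigid expression. -/
def toQ : REx → ResExpr := Sum.map rmk toMul

/-- A choice of rigid representation of a resource expression. -/
noncomputable def outE : ResExpr → REx :=
  Sum.map rout (fun m => m.toList.map rout)

/-- Variable as a resource term. -/
def qVar (x : ℕ) : ResTerm := rmk (.var x)

/-- Abstraction on resource terms. -/
noncomputable def qLam (s : ResTerm) : ResTerm := rmk (.lam (rout s))

/-- Left injection `(-) ⊕ •` on resource terms. -/
noncomputable def qInl (s : ResTerm) : ResTerm := rmk (.inl (rout s))

/-- Right injection `• ⊕ (-)` on resource terms. -/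
noncomputable def qInr (s : ResTerm) : ResTerm := rmk (.inr (rout s))

/-- Application `⟨s⟩t̄` of a resource term to a resource monomial. -/
noncomputable def qApp (s : ResTerm) (t : Multiset ResTerm) : ResTerm :=
  rmk (.app (rout s) (t.toList.map rout))

/-! ### Occurrence counting and rigid substitution -/

namespace Rt

/-- Shift free de Bruijn indices `≥ c` up by one in a rigid term. -/
def shiftR (c : ℕ) : Rt → Rt
  | .var n => .var (if n < c then n else n + 1)
  | .lam a => .lam (a.shiftR (c + 1))
  | .inl a => .inl (a.shiftR c)
  | .inr a => .inr (a.shiftR c)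
  | .app d es => .app (d.shiftR c) (es.attach.map fun e => e.1.shiftR c)
termination_by r => sizeOf r
decreasing_by
  all_goals simp_wf
  all_goals try omega
  all_goals (have := List.sizeOf_lt_of_mem e.2; omega)

end Rt

/-- Number of free occurrences `n_x(a)` of the variable `x` in a rigid term. -/
def nx (x : ℕ) : Rt → ℕ
  | .var n => if n = x then 1 else 0
  | .lam a => nx (x + 1) a
  | .inl a => nx x a
  | .inr a => nx x a
  | .app d es => nx x d + (es.attach.map fun e => nx x e.1).sum
termination_by r => sizeOf r
decreasing_by
  all_goals simp_wf
  all_goals try omega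
  all_goals (have := List.sizeOf_lt_of_mem e.2; omega)

/-- Number of free occurrences of `x` in a rigid monomial. -/
def nxL (x : ℕ) (l : List Rt) : ℕ := (l.map (nx x)).sum

/-- Number of free occurrences of `x` in a rigid expression. -/
def nxE (x : ℕ) : REx → ℕ := Sum.elim (nx x) (nxL x)

mutual
  /-- Rigid substitution `r[b⃗/x]`: the occurrences of `x` in `r`, taken from
  left to right, are replaced by the successive elements of `b⃗`; it is
  undefined (`none`, i.e. the partial rigid expression `0`) unless `n_x(r) = |b⃗|`. -/
  def rsubst : Rt → ℕ → List Rt → Option Rt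
    | .var n, x, bs =>
        if n = x then (match bs with | [b] => some b | _ => none)
        else (match bs with
              | [] => some (.var (if x < n then n - 1 else n))
              | _ => none)
    | .lam a, x, bs => (rsubst a (x + 1) (bs.map (Rt.shiftR 0))).map .lam
    | .inl a, x, bs => (rsubst a x bs).map .inl
    | .inr a, x, bs => (rsubst a x bs).map .inr
    | .app c ds, x, bs =>
        match rsubst c x (bs.take (nx x c)), rsubstL ds x (bs.drop (nx x c)) with
        | some c', some ds' => some (.app c' ds')
        | _, _ => none
  /-- Rigid substitution in a rigid monomial. -/
  def rsubstL : List Rt → ℕ → List Rt → Option (List Rt)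
    | [], _, bs => (match bs with | [] => some [] | _ => none)
    | a :: as, x, bs =>
        match rsubst a x (bs.take (nx x a)), rsubstL as x (bs.drop (nx x a)) with
        | some a', some as' => some (a' :: as')
        | _, _ => none
end

/-- Rigid substitution on rigid expressions. -/
def rsubstE : REx → ℕ → List Rt → Option REx
  | .inl r, x, bs => (rsubst r x bs).map .inl
  | .inr l, x, bs => (rsubstL l x bs).map .inr

/-- Left action of a permutation on a list:
`σ·(b₁,…,bₙ) = (b_{σ⁻¹(1)},…,b_{σ⁻¹(n)})` (identity if the length is not `n`). -/
def permList {α : Type*} {n : ℕ} (σ : Equiv.Perm (Fin n)) (l : List α) : List α :=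
  if h : l.length = n then List.ofFn (fun j : Fin n => l.get ((σ.symm j).cast h.symm))
  else l

/-! ### Symmetric multilinear substitution -/

/-- Symmetric multilinear substitution computed on rigid representatives:
`∑_{σ ∈ S_n} |r[σ·b⃗/x]|`, as a finite ℕ-linear sum of resource expressions. -/
noncomputable def dsubRig (x : ℕ) (r : REx) (bs : List Rt) : ResExpr →₀ ℕ :=
  ∑ σ : Equiv.Perm (Fin bs.length),
    (rsubstE r x (permList σ bs)).elim 0 (fun u => Finsupp.single (toQ u) 1)

/-- The symmetric multilinear substitution `∂_x e · t̄`, a finite ℕ-linear sum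
of resource expressions. -/
noncomputable def dsub (x : ℕ) (e : ResExpr) (t : Multiset ResTerm) : ResExpr →₀ ℕ :=
  dsubRig x (outE e) (t.toList.map rout)


/-! ### Rigid terms: induction and isomorphism -/

/-- Simultaneous structural induction on rigid terms and rigid monomials. -/
theorem Rt.induction_mutual {P : Rt → Prop} {Q : List Rt → Prop}
    (var : ∀ n, P (.var n)) (lam : ∀ a, P a → P (.lam a))
    (app : ∀ c ds, P c → Q ds → P (.app c ds))
    (inl : ∀ a, P a → P (.inl a)) (inr : ∀ a, P a → P (.inr a))
    (nil : Q []) (cons : ∀ a as, P a → Q as → Q (a :: as)) :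
    (∀ r, P r) ∧ ∀ l, Q l :=
  ⟨fun r => Rt.rec (motive_1 := P) (motive_2 := Q) var lam app inl inr nil cons r,
    fun l => Rt.rec_1 (motive_1 := P) (motive_2 := Q) var lam app inl inr nil cons l⟩

theorem isoM_iff {as as' : List Rt} :
    IsoM as as' ↔
      ∃ e : Fin as.length ≃ Fin as'.length, ∀ i, IsoT (as.get i) (as'.get (e i)) := by
  constructor
  · rintro ⟨_, _, h, σ, H⟩
    exact ⟨σ.trans (finCongr h.symm), H⟩
  · rintro ⟨e, H⟩
    have h : as'.length = as.length := (Fin.equiv_iff_eq.1 ⟨e⟩).symm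
    exact ⟨as, as', h, e.trans (finCongr h), H⟩

/-- Mutual induction on isomorphisms, with permutations of arguments presented as bijections
of positions. -/
theorem iso_induction {P : Rt → Rt → Prop} {Q : List Rt → List Rt → Prop}
    (var : ∀ n, P (.var n) (.var n))
    (lam : ∀ a a', P a a' → P (.lam a) (.lam a'))
    (inl : ∀ a a', P a a' → P (.inl a) (.inl a'))
    (inr : ∀ a a', P a a' → P (.inr a) (.inr a'))
    (app : ∀ c c' ds ds', P c c' → Q ds ds' → P (.app c ds) (.app c' ds'))
    (list : ∀ (as as' : List Rt) (e : Fin as.length ≃ Fin as'.length),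
      (∀ i, P (as.get i) (as'.get (e i))) → Q as as') :
    (∀ a a', IsoT a a' → P a a') ∧ ∀ as as', IsoM as as' → Q as as' := by
  have key : ∀ a a', IsoT a a' → P a a' := fun a a' h =>
    IsoT.rec (motive_1 := fun a a' _ => P a a') (motive_2 := fun as as' _ => Q as as')
      var (fun _ => lam _ _) (fun _ => inl _ _) (fun _ => inr _ _)
      (fun _ _ => app _ _ _ _)
      (fun as as' h σ _ H => list as as' (σ.trans (finCongr h.symm)) H) h
  refine ⟨key, fun as as' h => ?_⟩
  obtain ⟨e, H⟩ := isoM_iff.1 h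
  exact list as as' e fun i => key _ _ (H i)

theorem IsoM.of_forall₂ {as as' : List Rt} (h : List.Forall₂ IsoT as as') : IsoM as as' :=
  isoM_iff.2 ⟨finCongr h.length_eq, fun i => h.get i.2 (h.length_eq ▸ i.2)⟩

theorem IsoT.refl (a : Rt) : IsoT a a :=
  (Rt.induction_mutual (P := fun a => IsoT a a) (Q := fun l => List.Forall₂ IsoT l l)
    .var (fun _ => .lam) (fun _ _ hc hd => .app hc (.of_forall₂ hd)) (fun _ => .inl)
    (fun _ => .inr) .nil (fun _ _ => .cons)).1 a

theorem IsoT.symm {a b : Rt} (h : IsoT a b) : IsoT b a :=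
  (iso_induction (P := fun a b => IsoT b a) (Q := fun as bs => IsoM bs as)
    .var (fun _ _ => .lam) (fun _ _ => .inl) (fun _ _ => .inr) (fun _ _ _ _ => .app)
    (fun as as' e H => isoM_iff.2 ⟨e.symm, fun i => by simpa using H (e.symm i)⟩)).1 a b h

theorem IsoT.trans {a b c : Rt} (h : IsoT a b) (h' : IsoT b c) : IsoT a c := by
  refine (iso_induction (P := fun a b => ∀ c, IsoT b c → IsoT a c)
    (Q := fun as bs => ∀ cs, IsoM bs cs → IsoM as cs) ?_ ?_ ?_ ?_ ?_ ?_).1 a b h c h'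
  · exact fun _ _ h => h
  · rintro a a' ih _ ⟨⟩
    exact .lam (ih _ ‹_›)
  · rintro a a' ih _ ⟨⟩
    exact .inl (ih _ ‹_›)
  · rintro a a' ih _ ⟨⟩
    exact .inr (ih _ ‹_›)
  · rintro c c' ds ds' ihc ihd _ ⟨⟩
    exact .app (ihc _ ‹_›) (ihd _ ‹_›)
  · intro as as' e H cs hcs
    obtain ⟨e', H'⟩ := isoM_iff.1 hcs
    exact isoM_iff.2 ⟨e.trans e', fun i => H i _ (H' _)⟩

theorem IsoT.equivalence : Equivalence IsoT := ⟨.refl, .symm, .trans⟩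

theorem rmk_eq_rmk {a b : Rt} : rmk a = rmk b ↔ IsoT a b :=
  IsoT.equivalence.quot_mk_eq_iff a b

theorem exists_equiv_of_map_univ_val_eq {α β γ : Type*} [Fintype α] [Fintype β] {f : α → γ}
    {g : β → γ} (h : Finset.univ.val.map f = Finset.univ.val.map g) :
    ∃ e : α ≃ β, ∀ a, g (e a) = f a := by
  classical
  have hc (c : γ) : Nonempty ({a // f a = c} ≃ {b // g b = c}) := by
    rw [← Fintype.card_eq, Fintype.card_subtype, Fintype.card_subtype]
    have := congrArg (Multiset.count c) h
    rw [Multiset.count_map, Multiset.count_map] at this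
    simp only [eq_comm (a := c)] at this
    exact this
  exact ⟨Equiv.ofFiberEquiv fun c => (hc c).some, Equiv.ofFiberEquiv_map _⟩

theorem toMul_eq_toMul {as bs : List Rt} : toMul as = toMul bs ↔ IsoM as bs := by
  have toMul_eq (l : List Rt) : toMul l = Finset.univ.val.map fun i => rmk (l.get i) := by
    rw [toMul, Fin.univ_val_map]
    congr 1
    exact List.ext_get (by simp) (by simp)
  rw [isoM_iff]
  constructor
  · intro h
    rw [toMul_eq, toMul_eq] at h
    obtain ⟨e, he⟩ := exists_equiv_of_map_univ_val_eq h
    exact ⟨e, fun i => rmk_eq_rmk.1 (he i).symm⟩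
  · rintro ⟨e, H⟩
    rw [toMul_eq, toMul_eq, ← Multiset.map_univ_val_equiv e, Multiset.map_map]
    exact Multiset.map_congr rfl fun i _ => rmk_eq_rmk.2 (H i)

theorem IsoM.refl (as : List Rt) : IsoM as as := toMul_eq_toMul.1 rfl

theorem IsoM.trans {as bs cs : List Rt} (h : IsoM as bs) (h' : IsoM bs cs) : IsoM as cs :=
  toMul_eq_toMul.1 ((toMul_eq_toMul.2 h).trans (toMul_eq_toMul.2 h'))

theorem IsoM.cons {a a' : Rt} {as as' : List Rt} (h : IsoT a a') (h' : IsoM as as') :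
    IsoM (a :: as) (a' :: as') := by
  rw [← toMul_eq_toMul] at h' ⊢
  rw [← rmk_eq_rmk] at h
  simp only [toMul, List.map_cons, ← Multiset.cons_coe] at h' ⊢
  rw [h, h']

theorem IsoM.swap (a b : Rt) (l : List Rt) : IsoM (b :: a :: l) (a :: b :: l) :=
  toMul_eq_toMul.1 (Quot.sound (.swap _ _ _))

theorem Rt.shiftR_app (c : ℕ) (d : Rt) (es : List Rt) :
    (Rt.app d es).shiftR c = .app (d.shiftR c) (es.map (Rt.shiftR c)) := by
  rw [Rt.shiftR, List.attach_map_val (f := Rt.shiftR c)]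

theorem IsoT.shiftR {a b : Rt} (h : IsoT a b) : ∀ c, IsoT (a.shiftR c) (b.shiftR c) := by
  refine (iso_induction (P := fun a b => ∀ c, IsoT (a.shiftR c) (b.shiftR c))
    (Q := fun as bs => ∀ c, IsoM (as.map (Rt.shiftR c)) (bs.map (Rt.shiftR c)))
    ?_ ?_ ?_ ?_ ?_ ?_).1 a b h
  · exact fun _ _ => .refl _
  · intro a a' ih c
    simpa only [Rt.shiftR] using IsoT.lam (ih (c + 1))
  · intro a a' ih c
    simpa only [Rt.shiftR] using IsoT.inl (ih c)
  · intro a a' ih c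
    simpa only [Rt.shiftR] using IsoT.inr (ih c)
  · intro c c' ds ds' ihc ihd k
    simpa only [Rt.shiftR_app] using IsoT.app (ihc k) (ihd k)
  · intro as as' e H c
    refine isoM_iff.2 ⟨(finCongr (by simp)).trans (e.trans (finCongr (by simp))), fun i => ?_⟩
    simpa using H (i.cast (by simp)) c

/-! ### Rigid substitution -/

theorem nx_app (x : ℕ) (c : Rt) (ds : List Rt) : nx x (.app c ds) = nx x c + nxL x ds := by
  rw [nx, List.attach_map_val (f := nx x), nxL]

theorem nxL_cons (x : ℕ) (a : Rt) (as : List Rt) : nxL x (a :: as) = nx x a + nxL x as := by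
  simp [nxL]

theorem rsubst_app_append {c : Rt} {ds : List Rt} {x : ℕ} {bs bs' : List Rt}
    (h : bs.length = nx x c) :
    rsubst (.app c ds) x (bs ++ bs') = Option.map₂ .app (rsubst c x bs) (rsubstL ds x bs') := by
  rw [rsubst, ← h, List.take_left, List.drop_left]
  cases rsubst c x bs <;> cases rsubstL ds x bs' <;> rfl

theorem rsubstL_cons_append {a : Rt} {as : List Rt} {x : ℕ} {bs bs' : List Rt}
    (h : bs.length = nx x a) :
    rsubstL (a :: as) x (bs ++ bs') = Option.map₂ .cons (rsubst a x bs) (rsubstL as x bs') := by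
  rw [rsubstL, ← h, List.take_left, List.drop_left]
  cases rsubst a x bs <;> cases rsubstL as x bs' <;> rfl

theorem length_eq_of_rsubst :
    (∀ r x bs u, rsubst r x bs = some u → bs.length = nx x r) ∧
      ∀ l x bs u, rsubstL l x bs = some u → bs.length = nxL x l := by
  refine Rt.induction_mutual ?_ ?_ ?_ ?_ ?_ ?_ ?_
  · intro n x bs u h
    rcases bs with _ | ⟨b, _ | _⟩ <;> by_cases hn : n = x <;> simp_all [rsubst, nx]
  · intro a ih x bs u h
    rw [rsubst, Option.map_eq_some_iff] at h
    obtain ⟨v, hv, -⟩ := h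
    simpa [nx] using ih _ _ _ hv
  · intro c ds ihc ihd x bs u h
    rw [rsubst] at h
    split at h
    · have h1 := ihc _ _ _ ‹_›
      have h2 := ihd _ _ _ ‹_›
      rw [nx_app, ← h2, ← List.length_append.trans (congrArg (· + _) h1), List.take_append_drop]
    · cases h
  · intro a ih x bs u h
    rw [rsubst, Option.map_eq_some_iff] at h
    obtain ⟨v, hv, -⟩ := h
    simpa [nx] using ih _ _ _ hv
  · intro a ih x bs u h
    rw [rsubst, Option.map_eq_some_iff] at h
    obtain ⟨v, hv, -⟩ := h
    simpa [nx] using ih _ _ _ hv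
  · intro x bs u h
    cases bs
    · rfl
    · simp [rsubstL] at h
  · intro a as iha ihas x bs u h
    rw [rsubstL] at h
    split at h
    · have h1 := iha _ _ _ ‹_›
      have h2 := ihas _ _ _ ‹_›
      rw [nxL_cons, ← h2, ← List.length_append.trans (congrArg (· + _) h1),
        List.take_append_drop]
    · cases h

theorem optionRel_map {α β γ δ : Type*} {R : α → β → Prop} {S : γ → δ → Prop} {f : α → γ}
    {g : β → δ} (H : ∀ a b, R a b → S (f a) (g b)) {a : Option α} {b : Option β}
    (h : Option.Rel R a b) : Option.Rel S (a.map f) (b.map g) := by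
  cases h with
  | some h => exact .some (H _ _ h)
  | none => exact .none

theorem optionRel_map₂ {α α' β β' γ γ' : Type*} {R : α → α' → Prop} {S : β → β' → Prop}
    {T : γ → γ' → Prop} {f : α → β → γ} {g : α' → β' → γ'}
    (H : ∀ a a' b b', R a a' → S b b' → T (f a b) (g a' b'))
    {a : Option α} {a' : Option α'} {b : Option β} {b' : Option β'}
    (h : Option.Rel R a a') (h' : Option.Rel S b b') :
    Option.Rel T (Option.map₂ f a b) (Option.map₂ g a' b') := by
  cases h with
  | none => exact .none
  | some h =>
    cases h' with
    | none => exact .none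
    | some h' => exact .some (H _ _ _ _ h h')

theorem rsubst_congr :
    (∀ r x bs bs', List.Forall₂ IsoT bs bs' →
        Option.Rel IsoT (rsubst r x bs) (rsubst r x bs')) ∧
      ∀ l x bs bs', List.Forall₂ IsoT bs bs' →
        Option.Rel IsoM (rsubstL l x bs) (rsubstL l x bs') := by
  refine Rt.induction_mutual ?_ ?_ ?_ ?_ ?_ ?_ ?_
  · intro n x bs bs' h
    rcases h with _ | ⟨h, _ | _⟩ <;> by_cases hn : n = x <;>
      simp only [rsubst, hn, if_true, if_false]
    exacts [.none, .some (.refl _), .some h, .none, .none, .none]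
  · intro a ih x bs bs' h
    rw [rsubst, rsubst]
    refine optionRel_map (fun _ _ => .lam) (ih _ _ _ ?_)
    rw [List.forall₂_map_left_iff, List.forall₂_map_right_iff]
    exact h.imp fun _ _ h => h.shiftR 0
  · intro c ds ihc ihd x bs bs' h
    have hc := ihc x _ _ (List.forall₂_take (nx x c) h)
    have hd := ihd x _ _ (List.forall₂_drop (nx x c) h)
    rw [rsubst, rsubst]
    revert hc hd
    generalize rsubst c x (bs.take _) = o₁
    generalize rsubst c x (bs'.take _) = o₂
    generalize rsubstL ds x (bs.drop _) = o₃
    generalize rsubstL ds x (bs'.drop _) = o₄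
    rintro (hc | _) (hd | _)
    exacts [.some (.app hc hd), .none, .none, .none]
  · intro a ih x bs bs' h
    rw [rsubst, rsubst]
    exact optionRel_map (fun _ _ => .inl) (ih _ _ _ h)
  · intro a ih x bs bs' h
    rw [rsubst, rsubst]
    exact optionRel_map (fun _ _ => .inr) (ih _ _ _ h)
  · rintro x _ _ (_ | _)
    exacts [.some (.refl _), .none]
  · intro a as iha ihas x bs bs' h
    have hc := iha x _ _ (List.forall₂_take (nx x a) h)
    have hd := ihas x _ _ (List.forall₂_drop (nx x a) h)
    rw [rsubstL, rsubstL]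
    revert hc hd
    generalize rsubst a x (bs.take _) = o₁
    generalize rsubst a x (bs'.take _) = o₂
    generalize rsubstL as x (bs.drop _) = o₃
    generalize rsubstL as x (bs'.drop _) = o₄
    rintro (hc | _) (hd | _)
    exacts [.some (.cons hc hd), .none, .none, .none]

/-! ### Reindexing functions on lists -/

theorem exists_eq_ofFn {α : Type*} {n : ℕ} {l : List α} (h : l.length = n) :
    ∃ v : Fin n → α, l = List.ofFn v := by
  subst h
  exact ⟨l.get, (List.ofFn_get l).symm⟩

theorem exists_eq_append {α : Type*} {n m : ℕ} {l : List α} (h : l.length = n + m) :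
    ∃ l₁ l₂ : List α, l = l₁ ++ l₂ ∧ l₁.length = n ∧ l₂.length = m :=
  ⟨l.take n, l.drop n, (List.take_append_drop n l).symm, by simp [h], by simp [h]⟩

/-- `g` permutes the entries of lists of length `n`, by a fixed permutation of positions. -/
def IsReindexing (n : ℕ) (g : List Rt → List Rt) : Prop :=
  ∃ π : Equiv.Perm (Fin n), ∀ v : Fin n → Rt, g (List.ofFn v) = List.ofFn (v ∘ π)

namespace IsReindexing

variable {n m : ℕ} {f g : List Rt → List Rt}

theorem length_eq (hg : IsReindexing n g) {l : List Rt} (h : l.length = n) :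
    (g l).length = n := by
  obtain ⟨π, H⟩ := hg
  obtain ⟨v, rfl⟩ := exists_eq_ofFn h
  simp [H]

theorem map_comm (hg : IsReindexing n g) (k : Rt → Rt) {l : List Rt} (h : l.length = n) :
    (g l).map k = g (l.map k) := by
  obtain ⟨π, H⟩ := hg
  obtain ⟨v, rfl⟩ := exists_eq_ofFn h
  rw [H, List.map_ofFn, List.map_ofFn, H]
  rfl

protected theorem id (n : ℕ) : IsReindexing n id := ⟨1, fun _ => rfl⟩

theorem comp (hf : IsReindexing n f) (hg : IsReindexing n g) : IsReindexing n (f ∘ g) := by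
  obtain ⟨π, H⟩ := hf
  obtain ⟨ρ, K⟩ := hg
  refine ⟨ρ * π, fun v => ?_⟩
  rw [Function.comp_apply, K, H]
  rfl

theorem append (hf : IsReindexing n f) (hg : IsReindexing m g) :
    IsReindexing (n + m) (fun l => f (l.take n) ++ g (l.drop n)) := by
  obtain ⟨π, H⟩ := hf
  obtain ⟨ρ, K⟩ := hg
  refine ⟨finSumFinEquiv.permCongr (Equiv.Perm.sumCongr π ρ), fun v => ?_⟩
  obtain ⟨v₁, v₂, rfl⟩ : ∃ v₁ v₂, v = Fin.append v₁ v₂ := ⟨_, _, (Fin.append_castAdd_natAdd).symm⟩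
  have h₁ : (List.ofFn (Fin.append v₁ v₂)).take n = List.ofFn v₁ := by
    rw [List.ofFn_fin_append, List.take_left' (by simp)]
  have h₂ : (List.ofFn (Fin.append v₁ v₂)).drop n = List.ofFn v₂ := by
    rw [List.ofFn_fin_append, List.drop_left' (by simp)]
  beta_reduce
  rw [h₁, h₂, H, K, ← List.ofFn_fin_append]
  congr 1
  funext i
  refine Fin.addCases (fun i => ?_) (fun i => ?_) i <;> simp [Equiv.permCongr_apply]

theorem swap (n m : ℕ) : IsReindexing (n + m) (fun l => l.drop n ++ l.take n) := by
  refine ⟨(finCongr (Nat.add_comm n m)).trans finAddFlip, fun v => ?_⟩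
  obtain ⟨v₁, v₂, rfl⟩ : ∃ v₁ v₂, v = Fin.append v₁ v₂ := ⟨_, _, (Fin.append_castAdd_natAdd).symm⟩
  have h₁ : (List.ofFn (Fin.append v₁ v₂)).take n = List.ofFn v₁ := by
    rw [List.ofFn_fin_append, List.take_left' (by simp)]
  have h₂ : (List.ofFn (Fin.append v₁ v₂)).drop n = List.ofFn v₂ := by
    rw [List.ofFn_fin_append, List.drop_left' (by simp)]
  beta_reduce
  rw [h₁, h₂, ← List.ofFn_fin_append, List.ofFn_congr (Nat.add_comm n m)]
  congr 1
  funext i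
  refine Fin.addCases (fun i => ?_) (fun i => ?_) i <;> simp

end IsReindexing

/-! ### Substitution in isomorphic rigid expressions -/

/-- `a` and `a'` have the same occurrence counts, and substitution in `a'` agrees with
substitution in `a` up to isomorphism and a fixed reordering of the substituted list. -/
def SubstCompat {α : Type} (count : ℕ → α → ℕ) (subst : α → ℕ → List Rt → Option α)
    (R : α → α → Prop) (a a' : α) : Prop :=
  ∀ x, count x a' = count x a ∧ ∃ g, IsReindexing (count x a) g ∧
    ∀ bs, bs.length = count x a → Option.Rel R (subst a x bs) (subst a' x (g bs))

theorem SubstCompat.refl {α : Type} {count : ℕ → α → ℕ} {subst : α → ℕ → List Rt → Option α}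
    {R : α → α → Prop} (hR : ∀ a, R a a) (a : α) : SubstCompat count subst R a a := by
  refine fun x => ⟨rfl, id, .id _, fun bs _ => ?_⟩
  rw [id]
  cases subst a x bs with
  | none => exact .none
  | some b => exact .some (hR b)

theorem SubstCompat.trans {α : Type} {count : ℕ → α → ℕ} {subst : α → ℕ → List Rt → Option α}
    {R : α → α → Prop} (hR : ∀ a b c, R a b → R b c → R a c) {a b c : α}
    (h : SubstCompat count subst R a b) (h' : SubstCompat count subst R b c) :
    SubstCompat count subst R a c := by
  intro x
  obtain ⟨hx, g, hg, H⟩ := h x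
  obtain ⟨hx', g', hg', H'⟩ := h' x
  rw [hx] at hx' hg' H'
  refine ⟨hx', g' ∘ g, hg'.comp hg, fun bs hbs => ?_⟩
  have h1 := H bs hbs
  have h2 := H' (g bs) (hg.length_eq hbs)
  rw [Function.comp_apply]
  revert h1 h2
  generalize subst a x bs = o₁
  generalize subst b x (g bs) = o₂
  generalize subst c x (g' (g bs)) = o₃
  rintro (h1 | _) (h2 | _)
  exacts [.some (hR _ _ _ h1 h2), .none]

theorem SubstCompat.cons {a a' : Rt} {as as' : List Rt} (h : SubstCompat nx rsubst IsoT a a')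
    (h' : SubstCompat nxL rsubstL IsoM as as') :
    SubstCompat nxL rsubstL IsoM (a :: as) (a' :: as') := by
  intro x
  obtain ⟨hx, g, hg, H⟩ := h x
  obtain ⟨hx', g', hg', H'⟩ := h' x
  simp only [nxL_cons]
  refine ⟨by rw [hx, hx'], _, hg.append hg', fun bs hbs => ?_⟩
  obtain ⟨bs₁, bs₂, rfl, h₁, h₂⟩ := exists_eq_append hbs
  rw [rsubstL_cons_append h₁, List.take_left' h₁, List.drop_left' h₁,
    rsubstL_cons_append ((hg.length_eq h₁).trans hx.symm)]
  exact optionRel_map₂ (fun _ _ _ _ => .cons) (H _ h₁) (H' _ h₂)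

theorem SubstCompat.app {c c' : Rt} {ds ds' : List Rt} (h : SubstCompat nx rsubst IsoT c c')
    (h' : SubstCompat nxL rsubstL IsoM ds ds') :
    SubstCompat nx rsubst IsoT (.app c ds) (.app c' ds') := by
  intro x
  obtain ⟨hx, g, hg, H⟩ := h x
  obtain ⟨hx', g', hg', H'⟩ := h' x
  simp only [nx_app]
  refine ⟨by rw [hx, hx'], _, hg.append hg', fun bs hbs => ?_⟩
  obtain ⟨bs₁, bs₂, rfl, h₁, h₂⟩ := exists_eq_append hbs
  rw [rsubst_app_append h₁, List.take_left' h₁, List.drop_left' h₁,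
    rsubst_app_append ((hg.length_eq h₁).trans hx.symm)]
  exact optionRel_map₂ (fun _ _ _ _ => .app) (H _ h₁) (H' _ h₂)

theorem SubstCompat.swap (a b : Rt) (l : List Rt) :
    SubstCompat nxL rsubstL IsoM (b :: a :: l) (a :: b :: l) := by
  intro x
  simp only [nxL_cons, ← Nat.add_assoc]
  refine ⟨by rw [Nat.add_comm (nx x a)], _,
    (IsReindexing.swap (nx x b) (nx x a)).append (.id (nxL x l)), fun bs hbs => ?_⟩
  obtain ⟨bs', bs₃, rfl, h', h₃⟩ := exists_eq_append hbs
  obtain ⟨bs₁, bs₂, rfl, h₁, h₂⟩ := exists_eq_append h'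
  rw [List.take_left' h', List.drop_left' h', List.take_left' h₁, List.drop_left' h₁, id,
    List.append_assoc, List.append_assoc, rsubstL_cons_append h₁, rsubstL_cons_append h₂,
    rsubstL_cons_append h₂, rsubstL_cons_append h₁]
  cases rsubst b x bs₁ <;> cases rsubst a x bs₂ <;> cases rsubstL l x bs₃ <;>
    first | exact .none | exact .some (.swap _ _ _)

theorem SubstCompat.of_perm {as as' : List Rt} (h : as.Perm as') :
    SubstCompat nxL rsubstL IsoM as as' := by
  induction h with
  | nil => exact .refl .refl _
  | cons a _ ih => exact .cons (.refl .refl a) ih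
  | swap a b l => exact .swap a b l
  | trans _ _ ih ih' => exact ih.trans (fun _ _ _ => .trans) ih'

theorem SubstCompat.of_forall₂ {as as' : List Rt}
    (h : List.Forall₂ (SubstCompat nx rsubst IsoT) as as') :
    SubstCompat nxL rsubstL IsoM as as' := by
  induction h with
  | nil => exact .refl .refl _
  | cons h _ ih => exact .cons h ih

theorem substCompat_of_iso :
    (∀ a a', IsoT a a' → SubstCompat nx rsubst IsoT a a') ∧
      ∀ as as', IsoM as as' → SubstCompat nxL rsubstL IsoM as as' := by
  refine iso_induction ?_ ?_ ?_ ?_ ?_ ?_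
  · exact fun n => .refl .refl _
  · intro a a' ih x
    obtain ⟨hx, g, hg, H⟩ := ih (x + 1)
    simp only [nx, rsubst]
    refine ⟨hx, g, hg, fun bs hbs => ?_⟩
    rw [hg.map_comm _ hbs]
    exact optionRel_map (fun _ _ => .lam) (H _ (by simpa using hbs))
  · intro a a' ih x
    obtain ⟨hx, g, hg, H⟩ := ih x
    simp only [nx, rsubst]
    exact ⟨hx, g, hg, fun bs hbs => optionRel_map (fun _ _ => .inl) (H _ hbs)⟩
  · intro a a' ih x
    obtain ⟨hx, g, hg, H⟩ := ih x
    simp only [nx, rsubst]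
    exact ⟨hx, g, hg, fun bs hbs => optionRel_map (fun _ _ => .inr) (H _ hbs)⟩
  · exact fun c c' ds ds' => .app
  · intro as as' e H
    have h₁ : SubstCompat nxL rsubstL IsoM as (List.ofFn (as'.get ∘ e)) := by
      refine .of_forall₂ (List.forall₂_iff_get.2 ⟨by simp, fun i hi _ => ?_⟩)
      simpa using H ⟨i, hi⟩
    refine h₁.trans (fun _ _ _ => .trans) (.of_perm ?_)
    rw [← Multiset.coe_eq_coe, ← Fin.univ_val_map, ← Multiset.map_map,
      Multiset.map_univ_val_equiv, Fin.univ_val_map, List.ofFn_get]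

/-! ### Sums over permutations -/

theorem sum_permList {α M : Type*} [AddCommMonoid M] (F : List α → M) (l : List α) :
    ∑ σ : Equiv.Perm (Fin l.length), F (permList σ l) =
      ∑ σ : Equiv.Perm (Fin l.length), F (List.ofFn (l.get ∘ σ)) := by
  rw [← Equiv.sum_comp (Equiv.inv _)]
  refine Finset.sum_congr rfl fun σ _ => ?_
  rw [permList, dif_pos rfl]
  rfl

theorem sum_ofFn_comp_congr {α M : Type*} [AddCommMonoid M] {R : α → α → Prop} {F : List α → M}
    (hF : ∀ l l', List.Forall₂ R l l' → F l = F l') {n m : ℕ} {v : Fin n → α} {w : Fin m → α}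
    (e : Fin n ≃ Fin m) (h : ∀ i, R (v i) (w (e i))) :
    ∑ σ : Equiv.Perm (Fin n), F (List.ofFn (v ∘ σ)) =
      ∑ σ : Equiv.Perm (Fin m), F (List.ofFn (w ∘ σ)) := by
  obtain rfl := Fin.equiv_iff_eq.1 ⟨e⟩
  rw [← Equiv.sum_comp (Equiv.mulLeft (e : Equiv.Perm (Fin n)))
    fun σ : Equiv.Perm (Fin n) => F (List.ofFn (w ∘ σ))]
  refine Finset.sum_congr rfl fun σ _ => hF _ _ ?_
  exact List.forall₂_iff_get.2 ⟨by simp, fun i hi _ => by simpa using h _⟩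

/-- The summand `|r[b⃗/x]|` of the symmetric multilinear substitution. -/
noncomputable def rsubstSummand (x : ℕ) (r : REx) (bs : List Rt) : ResExpr →₀ ℕ :=
  (rsubstE r x bs).elim 0 (fun u => Finsupp.single (toQ u) 1)

theorem dsubRig_eq_sum (x : ℕ) (r : REx) (bs : List Rt) :
    dsubRig x r bs =
      ∑ σ : Equiv.Perm (Fin bs.length), rsubstSummand x r (List.ofFn (bs.get ∘ σ)) :=
  sum_permList (rsubstSummand x r) bs

theorem rsubstSummand_eq_zero {x : ℕ} {r : REx} {bs : List Rt} (h : bs.length ≠ nxE x r) :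
    rsubstSummand x r bs = 0 := by
  rcases r with r | l
  · have : rsubst r x bs = none :=
      Option.eq_none_iff_forall_ne_some.2 fun u hu => h (length_eq_of_rsubst.1 _ _ _ u hu)
    simp [rsubstSummand, rsubstE, this]
  · have : rsubstL l x bs = none :=
      Option.eq_none_iff_forall_ne_some.2 fun u hu => h (length_eq_of_rsubst.2 _ _ _ u hu)
    simp [rsubstSummand, rsubstE, this]

theorem rsubstSummand_inl_congr {x : ℕ} {r r' : Rt} {bs bs' : List Rt}
    (h : Option.Rel IsoT (rsubst r x bs) (rsubst r' x bs')) :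
    rsubstSummand x (.inl r) bs = rsubstSummand x (.inl r') bs' := by
  rw [rsubstSummand, rsubstSummand, rsubstE, rsubstE]
  revert h
  generalize rsubst r x bs = o₁
  generalize rsubst r' x bs' = o₂
  intro h
  cases h with
  | none => rfl
  | some h => simp [toQ, rmk_eq_rmk.2 h]

theorem rsubstSummand_inr_congr {x : ℕ} {l l' : List Rt} {bs bs' : List Rt}
    (h : Option.Rel IsoM (rsubstL l x bs) (rsubstL l' x bs')) :
    rsubstSummand x (.inr l) bs = rsubstSummand x (.inr l') bs' := by
  rw [rsubstSummand, rsubstSummand, rsubstE, rsubstE]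
  revert h
  generalize rsubstL l x bs = o₁
  generalize rsubstL l' x bs' = o₂
  intro h
  cases h with
  | none => rfl
  | some h => simp [toQ, toMul_eq_toMul.2 h]

theorem dsubRig_congr_right (x : ℕ) (r : REx) {bs bs' : List Rt} (h : IsoM bs bs') :
    dsubRig x r bs = dsubRig x r bs' := by
  obtain ⟨e, he⟩ := isoM_iff.1 h
  rw [dsubRig_eq_sum, dsubRig_eq_sum]
  refine sum_ofFn_comp_congr (fun l l' hl => ?_) e he
  rcases r with r | r
  · exact rsubstSummand_inl_congr (rsubst_congr.1 _ _ _ _ hl)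
  · exact rsubstSummand_inr_congr (rsubst_congr.2 _ _ _ _ hl)

theorem exists_reindexing_rsubstSummand (x : ℕ) {r r' : REx} (h : toQ r = toQ r') :
    nxE x r' = nxE x r ∧ ∃ g, IsReindexing (nxE x r) g ∧
      ∀ bs, bs.length = nxE x r → rsubstSummand x r bs = rsubstSummand x r' (g bs) := by
  rcases r with r | r <;> rcases r' with r' | r' <;> simp only [toQ, Sum.map_inl, Sum.map_inr,
    Sum.inl.injEq, Sum.inr.injEq, reduceCtorEq] at h
  · obtain ⟨hx, g, hg, H⟩ := substCompat_of_iso.1 _ _ (rmk_eq_rmk.1 h) x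
    exact ⟨hx, g, hg, fun bs hbs => rsubstSummand_inl_congr (H bs hbs)⟩
  · obtain ⟨hx, g, hg, H⟩ := substCompat_of_iso.2 _ _ (toMul_eq_toMul.1 h) x
    exact ⟨hx, g, hg, fun bs hbs => rsubstSummand_inr_congr (H bs hbs)⟩

theorem dsubRig_congr_left (x : ℕ) {r r' : REx} (h : toQ r = toQ r') (bs : List Rt) :
    dsubRig x r bs = dsubRig x r' bs := by
  obtain ⟨hx, g, ⟨π, hπ⟩, H⟩ := exists_reindexing_rsubstSummand x h
  rw [dsubRig_eq_sum, dsubRig_eq_sum]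
  by_cases hn : nxE x r = bs.length
  · rw [hn] at H
    generalize nxE x r = n at π hπ hn
    subst hn
    rw [← Equiv.sum_comp (Equiv.mulRight π)
      fun σ : Equiv.Perm (Fin bs.length) => rsubstSummand x r' (List.ofFn (bs.get ∘ σ))]
    refine Finset.sum_congr rfl fun σ _ => ?_
    rw [H _ (by simp), hπ]
    rfl
  · refine Finset.sum_congr rfl fun σ _ => ?_
    rw [rsubstSummand_eq_zero (by simpa using Ne.symm hn),
      rsubstSummand_eq_zero (by simpa [hx] using Ne.symm hn)]

theorem rmk_rout (s : ResTerm) : rmk (rout s) = s := Quot.out_eq s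

theorem toMul_map_rout (t : Multiset ResTerm) : toMul (t.toList.map rout) = t := by
  simp [toMul, Function.comp_def, rmk_rout]

theorem toQ_outE (e : ResExpr) : toQ (outE e) = e := by
  rcases e with s | t
  · simp [toQ, outE, rmk_rout]
  · simp [toQ, outE, toMul_map_rout]

/-! ### STATEMENT 13:
If `r ◁ e` and `b⃗ ◁ t̄`, then `n_x(r) = n_x(e)`, `|b⃗| = |t̄|`, and
`∂_x e · t̄ = Σ_{σ ∈ S_{|b⃗|}} |r[σ·b⃗/x]|` as finite ℕ-linear sums of resource
expressions (summands being `0` where the rigid substitution is undefined). -/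
theorem dsub_eq_sum_rigid_substitutions (x : ℕ) (r : REx) (e : ResExpr)
    (bs : List Rt) (t : Multiset ResTerm) (hr : toQ r = e) (hb : toMul bs = t) :
    nxE x r = nxE x (outE e) ∧ bs.length = Multiset.card t ∧
    dsub x e t =
      ∑ σ : Equiv.Perm (Fin bs.length),
        (rsubstE r x (permList σ bs)).elim 0 (fun u => Finsupp.single (toQ u) 1) := by
  subst hr hb
  have hq := toQ_outE (toQ r)
  refine ⟨(exists_reindexing_rsubstSummand x hq).1, by simp [toMul], ?_⟩
  rw [dsub, dsubRig_congr_left x hq,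
    dsubRig_congr_right x r (toMul_eq_toMul.1 (toMul_map_rout (toMul bs)))]
  rfl
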